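/- arXiv:1701.05658 — 7 statements merged into one kernel-verified Lean document; each statement's English description precedes it below -/
import Mathlib

section
/- Let k ≥ 2 be an integer and for each j ∈ ℤ let T_j = {e^{iz}(cos r, e^{i(j−1)π/k} sin r) : r,z ∈ ℝ} ⊂ S³. Then for all integers j, ℓ with j − ℓ not divisible by k, the intersection T_j ∩ T_ℓ equals C₁ ∪ C₂. -/
open Complex Real

/-- The great circle `C₁ = {(e^{it},0)}`. -/
def circC1 : Set (ℂ × ℂ) := {p | ∃ t : ℝ, p = (Complex.exp (t * Complex.I), 0)}

/-- The great circle `C₂ = {(0,e^{it})}`. -/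
def circC2 : Set (ℂ × ℂ) := {p | ∃ t : ℝ, p = (0, Complex.exp (t * Complex.I))}

/-- The Clifford torus `T_j = {e^{iz}(cos r, e^{i(j−1)π/k} sin r)}`. -/
noncomputable def torusT (k : ℕ) (j : ℤ) : Set (ℂ × ℂ) :=
  {p | ∃ r z : ℝ,
    p = (Complex.exp (z * Complex.I) * (Real.cos r : ℂ),
         Complex.exp (z * Complex.I) *
           Complex.exp (((((j : ℝ) - 1) * π / k : ℝ) : ℂ) * Complex.I) * (Real.sin r : ℂ))}

lemma exp_mul_I_mul_conj (t : ℝ) :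
    Complex.exp (t * Complex.I) * (starRingEnd ℂ) (Complex.exp (t * Complex.I)) = 1 := by
  rw [Complex.mul_conj, Complex.normSq_eq_norm_sq, Complex.norm_exp_ofReal_mul_I]
  norm_num

lemma exists_exp_mul_I_eq_mul_of_sq_eq_one (t : ℝ) {c : ℝ} (hc : c ^ 2 = 1) :
    ∃ s : ℝ, Complex.exp (t * Complex.I) * (c : ℂ) = Complex.exp (s * Complex.I) := by
  rcases sq_eq_one_iff.mp hc with rfl | rfl
  · exact ⟨t, by simp⟩
  · refine ⟨t + π, ?_⟩
    push_cast
    rw [add_mul, Complex.exp_add, Complex.exp_pi_mul_I]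

/-- Two real lines through the origin of `ℂ` whose angles do not differ by a multiple of `π`
meet only at the origin. -/
lemma eq_zero_of_exp_mul_I_mul_eq {θ θ' a b : ℝ} (hθ : Real.sin (θ - θ') ≠ 0)
    (h : Complex.exp (θ * Complex.I) * (a : ℂ) = Complex.exp (θ' * Complex.I) * (b : ℂ)) :
    a = 0 := by
  have h1 : Complex.exp (((θ - θ' : ℝ) : ℂ) * Complex.I) * (a : ℂ) = b := by
    push_cast
    rw [sub_mul, Complex.exp_sub, div_mul_eq_mul_div, h,
      mul_div_cancel_left₀ _ (Complex.exp_ne_zero _)]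
  have h2 := congrArg Complex.im h1
  rw [Complex.im_mul_ofReal, Complex.exp_ofReal_mul_I_im, Complex.ofReal_im] at h2
  exact (mul_eq_zero.mp h2).resolve_left hθ

lemma sin_int_sub_mul_pi_div_ne_zero {k : ℕ} (hk : k ≠ 0) {j ℓ : ℤ} (h : ¬ ((k : ℤ) ∣ (j - ℓ))) :
    Real.sin (((j : ℝ) - 1) * π / k - ((ℓ : ℝ) - 1) * π / k) ≠ 0 := by
  intro hs
  obtain ⟨n, hn⟩ := Real.sin_eq_zero_iff.mp hs
  refine h ⟨n, ?_⟩
  have hk' : (k : ℝ) ≠ 0 := Nat.cast_ne_zero.mpr hk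
  field_simp at hn
  have : (j : ℝ) - ℓ = k * n := by linarith
  exact_mod_cast this

lemma circC1_subset_torusT (k : ℕ) (j : ℤ) : circC1 ⊆ torusT k j := by
  rintro _ ⟨t, rfl⟩
  exact ⟨0, t, by simp⟩

lemma circC2_subset_torusT (k : ℕ) (j : ℤ) : circC2 ⊆ torusT k j := by
  rintro _ ⟨t, rfl⟩
  refine ⟨π / 2, t - ((j : ℝ) - 1) * π / k, ?_⟩
  rw [Real.cos_pi_div_two, Real.sin_pi_div_two, ← Complex.exp_add, ← add_mul, ← Complex.ofReal_add,
    sub_add_cancel]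
  simp

lemma snd_mul_conj_fst (r z θ : ℝ) :
    Complex.exp (z * Complex.I) * Complex.exp (θ * Complex.I) * (Real.sin r : ℂ) *
      (starRingEnd ℂ) (Complex.exp (z * Complex.I) * (Real.cos r : ℂ)) =
    Complex.exp (θ * Complex.I) * ((Real.sin r * Real.cos r : ℝ) : ℂ) := by
  rw [map_mul, Complex.conj_ofReal, Complex.ofReal_mul]
  linear_combination Complex.exp (θ * Complex.I) * (Real.sin r : ℂ) * (Real.cos r : ℂ) *
    exp_mul_I_mul_conj z

theorem torusT_inter_torusT (k : ℕ) (hk : 2 ≤ k) (j ℓ : ℤ) (h : ¬ ((k : ℤ) ∣ (j - ℓ))) :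
    torusT k j ∩ torusT k ℓ = circC1 ∪ circC2 := by
  refine Set.Subset.antisymm ?_ (Set.union_subset
    (Set.subset_inter (circC1_subset_torusT k j) (circC1_subset_torusT k ℓ))
    (Set.subset_inter (circC2_subset_torusT k j) (circC2_subset_torusT k ℓ)))
  rintro _ ⟨⟨r, z, rfl⟩, ⟨r', z', hp⟩⟩
  obtain ⟨hfst, hsnd⟩ := Prod.mk.inj hp
  have hlines := snd_mul_conj_fst r z (((j : ℝ) - 1) * π / k)
  rw [hfst, hsnd, snd_mul_conj_fst] at hlines
  have hsq := Real.sin_sq_add_cos_sq r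
  rcases mul_eq_zero.mp (eq_zero_of_exp_mul_I_mul_eq
    (sin_int_sub_mul_pi_div_ne_zero (by omega) h) hlines.symm) with hs | hc
  · obtain ⟨t, ht⟩ := exists_exp_mul_I_eq_mul_of_sq_eq_one z (c := Real.cos r) (by
      rwa [hs, zero_pow two_ne_zero, zero_add] at hsq)
    exact Or.inl ⟨t, by rw [ht, hs, Complex.ofReal_zero, mul_zero]⟩
  · obtain ⟨t, ht⟩ := exists_exp_mul_I_eq_mul_of_sq_eq_one (z + ((j : ℝ) - 1) * π / k)
      (c := Real.sin r) (by rwa [hc, zero_pow two_ne_zero, add_zero] at hsq)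
    refine Or.inr ⟨t, ?_⟩
    rw [← ht, hc, Complex.ofReal_zero, mul_zero, Complex.ofReal_add, add_mul, Complex.exp_add]
end

section
/- Any two Clifford tori in S³ intersect: for every ℝ-linear isometry A of ℝ⁴ ≅ ℂ², the image A(T') of the Clifford torus T' = {(e^{ix},e^{iy})/√2 : x,y ∈ ℝ} has nonempty intersection with T'. -/
open Complex Real

/-- The real inner product on `ℂ × ℂ ≅ ℝ⁴`. -/
noncomputable def realInner (p q : ℂ × ℂ) : ℝ :=
  (p.1 * (starRingEnd ℂ) q.1 + p.2 * (starRingEnd ℂ) q.2).re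

/-- The Clifford torus `T' = {(e^{ix},e^{iy})/√2}`. -/
def cliffordT' : Set (ℂ × ℂ) :=
  {p | ∃ x y : ℝ,
    p = (Complex.exp (x * Complex.I) / (Real.sqrt 2 : ℂ),
         Complex.exp (y * Complex.I) / (Real.sqrt 2 : ℂ))}

/-- The standard parametrization of the Clifford torus `T'`. -/
noncomputable def torusPoint (t : ℝ × ℝ) : ℂ × ℂ :=
  (Complex.exp (t.1 * Complex.I) / (Real.sqrt 2 : ℂ),
    Complex.exp (t.2 * Complex.I) / (Real.sqrt 2 : ℂ))

lemma continuous_torusPoint : Continuous torusPoint := by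
  unfold torusPoint
  simp only [div_eq_mul_inv]
  fun_prop

lemma realInner_self (p : ℂ × ℂ) : realInner p p = normSq p.1 + normSq p.2 := by
  simp [realInner, normSq_apply]

lemma realInner_torusPoint_self (t : ℝ × ℝ) :
    realInner (torusPoint t) (torusPoint t) = 1 := by
  rw [realInner_self]
  simp only [torusPoint, normSq_div, normSq_eq_norm_sq (Complex.exp _), norm_exp_ofReal_mul_I,
    normSq_ofReal, Real.mul_self_sqrt zero_le_two]
  norm_num

lemma exists_exp_of_normSq {z : ℂ} (hz : normSq z = 1 / 2) :
    ∃ x : ℝ, z = Complex.exp (x * Complex.I) / (Real.sqrt 2 : ℂ) := by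
  have h2 : (Real.sqrt 2 : ℂ) ≠ 0 := by simp
  have hn : ‖z * (Real.sqrt 2 : ℂ)‖ = 1 := by
    rw [← sq_eq_sq₀ (norm_nonneg _) zero_le_one, ← normSq_eq_norm_sq, normSq_mul, hz,
      normSq_ofReal, Real.mul_self_sqrt zero_le_two]
    norm_num
  obtain ⟨x, hx⟩ := (norm_eq_one_iff _).1 hn
  exact ⟨x, by rw [hx, mul_div_cancel_right₀ _ h2]⟩

/-- Parseval's identity for an orthonormal basis of `ℝ⁴` contained in the Clifford torus. -/
lemma sum_sq_realInner_torusPoint (u : ℂ × ℂ) :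
    realInner (torusPoint (0, 0)) u ^ 2 + realInner (torusPoint (0, π)) u ^ 2 +
      realInner (torusPoint (π / 2, π / 2)) u ^ 2 +
      realInner (torusPoint (π / 2, -(π / 2))) u ^ 2 = realInner u u := by
  have e : Complex.exp (-(π / 2) * Complex.I) = -Complex.I := by
    rw [neg_mul, Complex.exp_neg, exp_pi_div_two_mul_I, inv_I]
  have h : (Real.sqrt 2)⁻¹ ^ 2 = 1 / 2 := by
    rw [inv_pow, Real.sq_sqrt zero_le_two, one_div]
  simp only [torusPoint, realInner, ofReal_zero, ofReal_neg, ofReal_div, ofReal_ofNat, zero_mul,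
    Complex.exp_zero, exp_pi_mul_I, exp_pi_div_two_mul_I, e, div_eq_mul_inv _ (Real.sqrt 2 : ℂ),
    ← ofReal_inv]
  simp only [add_re, mul_re, mul_im, conj_re, conj_im, ofReal_re, ofReal_im, neg_re, neg_im,
    one_re, one_im, I_re, I_im]
  linear_combination 2 * (u.1.re ^ 2 + u.1.im ^ 2 + u.2.re ^ 2 + u.2.im ^ 2) * h

/-- Any two Clifford tori in `S³` intersect: the image of the Clifford torus `T'` under any
element of `O(4)` (an `ℝ`-linear automorphism of `ℝ⁴ ≅ ℂ²` preserving the real inner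
product) meets `T'`. -/
theorem cliffordTori_intersect (A : (ℂ × ℂ) ≃ₗ[ℝ] (ℂ × ℂ))
    (hA : ∀ v w : ℂ × ℂ, realInner (A v) (A w) = realInner v w) :
    ((⇑A '' cliffordT') ∩ cliffordT').Nonempty := by
  have parseval (e : ℂ × ℂ) :
      realInner (A (torusPoint (0, 0))) e ^ 2 + realInner (A (torusPoint (0, π))) e ^ 2 +
        realInner (A (torusPoint (π / 2, π / 2))) e ^ 2 +
        realInner (A (torusPoint (π / 2, -(π / 2)))) e ^ 2 = realInner e e := by
    have adj (p : ℂ × ℂ) : realInner (A p) e = realInner p (A.symm e) := by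
      rw [← hA p, A.apply_symm_apply]
    rw [adj, adj, adj, adj, sum_sq_realInner_torusPoint, ← adj, A.apply_symm_apply]
  have h₁ := parseval (1, 0)
  have h₂ := parseval (Complex.I, 0)
  have h₃ := parseval (0, 1)
  have h₄ := parseval (0, Complex.I)
  simp [realInner] at h₁ h₂ h₃ h₄
  let f : ℝ × ℝ → ℝ := fun t => normSq (A (torusPoint t)).1 - normSq (A (torusPoint t)).2
  have hf : Continuous f := by
    have hc : Continuous fun t => A (torusPoint t) :=
      (A.toLinearMap.continuous_of_finiteDimensional).comp continuous_torusPoint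
    exact (continuous_normSq.comp hc.fst).sub (continuous_normSq.comp hc.snd)
  have hsum : f (0, 0) + f (0, π) + f (π / 2, π / 2) + f (π / 2, -(π / 2)) = 0 := by
    simp only [f, normSq_apply]
    linear_combination h₁ + h₂ - h₃ - h₄
  have hle : ∃ t, f t ≤ 0 := by
    by_contra! h
    linarith [h (0, 0), h (0, π), h (π / 2, π / 2), h (π / 2, -(π / 2))]
  have hge : ∃ t, 0 ≤ f t := by
    by_contra! h
    linarith [h (0, 0), h (0, π), h (π / 2, π / 2), h (π / 2, -(π / 2))]
  obtain ⟨t, ht⟩ := mem_range_of_exists_le_of_exists_ge hf hle hge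
  have hnorm := hA (torusPoint t) (torusPoint t)
  rw [realInner_torusPoint_self, realInner_self] at hnorm
  simp only [f] at ht
  obtain ⟨x, hx⟩ := exists_exp_of_normSq (z := (A (torusPoint t)).1) (by linarith)
  obtain ⟨y, hy⟩ := exists_exp_of_normSq (z := (A (torusPoint t)).2) (by linarith)
  exact ⟨A (torusPoint t), ⟨torusPoint t, ⟨t.1, t.2, rfl⟩, rfl⟩, x, y, Prod.ext hx hy⟩
end

section
/- For every integer k > 2, the stabilizer in O(4) of the augmented configuration 𝒲'_k = 𝒲_k ∪ T' equals the stabilizer in O(4) of 𝒲_k: {A ∈ O(4) : A(𝒲'_k) = 𝒲'_k} = {A ∈ O(4) : A(𝒲_k) = 𝒲_k}. -/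
open Complex Real

/-- The configuration `𝒲_k = ⋃_{j=1}^k T_j`. -/
noncomputable def bigW (k : ℕ) : Set (ℂ × ℂ) := ⋃ j ∈ Finset.Icc (1 : ℤ) (k : ℤ), torusT k j

/-- The squared Euclidean norm `|z₁|² + |z₂|²`. -/
noncomputable def sqNorm (x : ℂ × ℂ) : ℝ := normSq x.1 + normSq x.2

/-- The quadratic form `|z₁|² - |z₂|²`, whose zero set is the cone over `T'`. -/
noncomputable def hyperForm (x : ℂ × ℂ) : ℝ := normSq x.1 - normSq x.2

theorem sqNorm_eq_realInner (x : ℂ × ℂ) : sqNorm x = realInner x x := by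
  simp [sqNorm, realInner, normSq_apply]

theorem sqNorm_smul (t : ℝ) (x : ℂ × ℂ) : sqNorm (t • x) = t ^ 2 * sqNorm x := by
  simp [sqNorm, normSq_apply]; ring

theorem hyperForm_smul (t : ℝ) (x : ℂ × ℂ) : hyperForm (t • x) = t ^ 2 * hyperForm x := by
  simp [hyperForm, normSq_apply]; ring

theorem hyperForm_zero : hyperForm 0 = 0 := by simp [hyperForm]

theorem sqNorm_pos {x : ℂ × ℂ} (hx : x ≠ 0) : 0 < sqNorm x := by
  have h1 := normSq_nonneg x.1
  have h2 := normSq_nonneg x.2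
  rcases eq_or_ne x.1 0 with h | h
  · have h' : x.2 ≠ 0 := fun h' => hx (Prod.ext h h')
    have := normSq_pos.2 h'
    unfold sqNorm; linarith
  · have := normSq_pos.2 h
    unfold sqNorm; linarith

theorem hyperForm_sq_le (x : ℂ × ℂ) : hyperForm x ^ 2 ≤ sqNorm x ^ 2 := by
  have := mul_nonneg (normSq_nonneg x.1) (normSq_nonneg x.2)
  unfold hyperForm sqNorm; nlinarith

theorem hyperForm_sq (x : ℂ × ℂ) :
    hyperForm x ^ 2 = sqNorm x ^ 2 - 4 * (normSq x.1 * normSq x.2) := by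
  unfold hyperForm sqNorm; ring

/-- The map `(s, t) ↦ (e^{is}, e^{it})`, written with real functions. -/
noncomputable def torusParam (p : ℝ × ℝ) : ℂ × ℂ :=
  (⟨Real.cos p.1, Real.sin p.1⟩, ⟨Real.cos p.2, Real.sin p.2⟩)

theorem map_eq_sum (B : (ℂ × ℂ) →ₗ[ℝ] (ℂ × ℂ)) (x : ℂ × ℂ) :
    B x = x.1.re • B (1, 0) + x.1.im • B (I, 0) + x.2.re • B (0, 1) + x.2.im • B (0, I) := by
  simp only [← map_smul, ← map_add]
  congr 1
  ext <;> simp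

theorem analyticOnNhd_hyperForm_torusParam (B : (ℂ × ℂ) →ₗ[ℝ] (ℂ × ℂ)) :
    AnalyticOnNhd ℝ (fun p => hyperForm (B (torusParam p))) Set.univ := by
  intro p _
  have hc1 : AnalyticAt ℝ (fun p : ℝ × ℝ => Real.cos p.1) p :=
    Real.analyticAt_cos.comp analyticAt_fst
  have hs1 : AnalyticAt ℝ (fun p : ℝ × ℝ => Real.sin p.1) p :=
    Real.analyticAt_sin.comp analyticAt_fst
  have hc2 : AnalyticAt ℝ (fun p : ℝ × ℝ => Real.cos p.2) p :=
    Real.analyticAt_cos.comp analyticAt_snd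
  have hs2 : AnalyticAt ℝ (fun p : ℝ × ℝ => Real.sin p.2) p :=
    Real.analyticAt_sin.comp analyticAt_snd
  have heq : (fun p => hyperForm (B (torusParam p))) = _ :=
    funext fun p => congrArg hyperForm (map_eq_sum B (torusParam p))
  rw [heq]
  simp only [torusParam, hyperForm, normSq_apply, Prod.fst_add, Prod.snd_add, Prod.smul_fst,
    Prod.smul_snd, add_re, add_im, smul_re, smul_im, smul_eq_mul]
  fun_prop

/-- If finitely many linear pullbacks of `hyperForm` have zero sets covering the cone
`{hyperForm = 0}`, then one of them alone vanishes on the points `(e^{is}, e^{it})`. -/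
theorem exists_forall_hyperForm_torusParam_eq_zero {ι : Type*} [Finite ι]
    (B : ι → (ℂ × ℂ) →ₗ[ℝ] (ℂ × ℂ))
    (hB : ∀ x, hyperForm x = 0 → ∃ l, hyperForm (B l x) = 0) :
    ∃ l, ∀ p, hyperForm (B l (torusParam p)) = 0 := by
  have hcover : ⋃ l, {p : ℝ × ℝ | hyperForm (B l (torusParam p)) = 0} = Set.univ := by
    refine Set.eq_univ_of_forall fun p => Set.mem_iUnion.2 (hB _ ?_)
    simp [hyperForm, torusParam, normSq_apply, ← sq]
  obtain ⟨l, q, hq⟩ := nonempty_interior_of_iUnion_of_closed (fun l =>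
    isClosed_eq (continuousOn_univ.1 (analyticOnNhd_hyperForm_torusParam (B l)).continuousOn)
      continuous_const) hcover
  refine ⟨l, fun p => ?_⟩
  exact (analyticOnNhd_hyperForm_torusParam (B l)).eqOn_zero_of_preconnected_of_eventuallyEq_zero
    isPreconnected_univ (Set.mem_univ q) (mem_interior_iff_mem_nhds.1 hq) (Set.mem_univ p)

/-- The polar form of `hyperForm`. -/
noncomputable def hyperPolar (x y : ℂ × ℂ) : ℝ :=
  2 * (x.1.re * y.1.re + x.1.im * y.1.im - x.2.re * y.2.re - x.2.im * y.2.im)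

theorem hyperForm_comb (a b c d : ℝ) (x y z w : ℂ × ℂ) :
    hyperForm (a • x + b • y + c • z + d • w) =
      a * a * hyperForm x + b * b * hyperForm y + c * c * hyperForm z + d * d * hyperForm w +
        a * b * hyperPolar x y + a * c * hyperPolar x z + a * d * hyperPolar x w +
        b * c * hyperPolar y z + b * d * hyperPolar y w + c * d * hyperPolar z w := by
  simp only [hyperPolar, hyperForm, normSq_apply, Prod.fst_add, Prod.snd_add, Prod.smul_fst,
    Prod.smul_snd, add_re, add_im, smul_re, smul_im, smul_eq_mul]
  ring

theorem exists_hyperForm_comp_eq_mul (B : (ℂ × ℂ) →ₗ[ℝ] (ℂ × ℂ))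
    (hB : ∀ p, hyperForm (B (torusParam p)) = 0) :
    ∃ c, ∀ x, hyperForm (B x) = c * hyperForm x := by
  refine ⟨hyperForm (B (1, 0)), fun x => ?_⟩
  have key (p : ℝ × ℝ) := (congrArg hyperForm (map_eq_sum B (torusParam p))).symm.trans (hB p)
  rw [map_eq_sum B x]
  clear hB
  generalize B (1, 0) = b₁ at *
  generalize B (I, 0) = b₂ at *
  generalize B (0, 1) = b₃ at *
  generalize B (0, I) = b₄ at *
  simp only [hyperForm_comb] at key ⊢
  generalize hyperForm b₁ = f₁ at *
  generalize hyperForm b₂ = f₂ at *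
  generalize hyperForm b₃ = f₃ at *
  generalize hyperForm b₄ = f₄ at *
  generalize hyperPolar b₁ b₂ = g₁₂ at *
  generalize hyperPolar b₁ b₃ = g₁₃ at *
  generalize hyperPolar b₁ b₄ = g₁₄ at *
  generalize hyperPolar b₂ b₃ = g₂₃ at *
  generalize hyperPolar b₂ b₄ = g₂₄ at *
  generalize hyperPolar b₃ b₄ = g₃₄ at *
  have k1 := key (0, 0)
  have k2 := key (0, π)
  have k3 := key (0, π / 2)
  have k4 := key (0, -(π / 2))
  have k5 := key (π / 2, 0)
  have k6 := key (π / 2, π)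
  have k7 := key (π / 2, π / 2)
  have k8 := key (π / 2, -(π / 2))
  have k9 := key (0, π / 4)
  have k10 := key (π / 4, 0)
  have hs : √2 * √2 = (2 : ℝ) := Real.mul_self_sqrt (by norm_num)
  simp [torusParam] at k1 k2 k3 k4 k5 k6 k7 k8 k9 k10
  have h13 : g₁₃ = 0 := by linarith
  have h14 : g₁₄ = 0 := by linarith
  have h23 : g₂₃ = 0 := by linarith
  have h24 : g₂₄ = 0 := by linarith
  have h2 : f₂ = f₁ := by linarith
  have h3 : f₃ = -f₁ := by linarith
  have h4 : f₄ = -f₁ := by linarith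
  subst h13 h14 h23 h24 h2 h3 h4
  have h12 : g₁₂ = 0 := by
    linear_combination 2 * k10 - (f₂ + g₁₂ / 2) * hs
  have h34 : g₃₄ = 0 := by
    linear_combination 2 * k9 + (f₂ - g₃₄ / 2) * hs
  subst h12 h34
  simp [hyperForm, normSq_apply]
  ring

theorem hyperForm_comp_sq_of_forall_torusParam (B : (ℂ × ℂ) ≃ₗ[ℝ] (ℂ × ℂ))
    (hB : ∀ x, sqNorm (B x) = sqNorm x) (h0 : ∀ p, hyperForm (B (torusParam p)) = 0) (x : ℂ × ℂ) :
    hyperForm (B x) ^ 2 = hyperForm x ^ 2 := by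
  obtain ⟨c, hc⟩ := exists_hyperForm_comp_eq_mul B.toLinearMap h0
  simp only [LinearEquiv.coe_coe] at hc
  have hN : hyperForm (1, 0) = 1 := by simp [hyperForm]
  have hM : sqNorm (1, 0) = 1 := by simp [sqNorm]
  have h1 := hyperForm_sq_le (B (1, 0))
  rw [hB, hc, hN, hM] at h1
  have h2 := hc (B.symm (1, 0))
  have h3 := hyperForm_sq_le (B.symm (1, 0))
  rw [← hB, LinearEquiv.apply_symm_apply, hM] at h3
  rw [LinearEquiv.apply_symm_apply, hN] at h2
  have hc2 : c ^ 2 = 1 := by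
    refine le_antisymm (by simpa using h1) ?_
    have : 1 = c ^ 2 * hyperForm (B.symm (1, 0)) ^ 2 := by rw [← mul_pow, ← h2, one_pow]
    nlinarith [sq_nonneg c]
  rw [hc, mul_pow, hc2, one_mul]

/-- An isometry preserving a finite union of isometric images of the cone `{hyperForm = 0}`
maps each of the corresponding quadratic forms to another one, up to sign. -/
theorem exists_hyperForm_comp_sq_eq {ι : Type*} [Finite ι]
    (U : ι → (ℂ × ℂ) ≃ₗ[ℝ] (ℂ × ℂ)) (hU : ∀ i x, sqNorm (U i x) = sqNorm x)
    (A : (ℂ × ℂ) ≃ₗ[ℝ] (ℂ × ℂ)) (hA : ∀ x, sqNorm (A x) = sqNorm x)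
    (h : ∀ x, (∃ i, hyperForm (U i x) = 0) → ∃ l, hyperForm (U l (A x)) = 0) (i : ι) :
    ∃ l, ∀ x, hyperForm (U l (A x)) ^ 2 = hyperForm (U i x) ^ 2 := by
  obtain ⟨l, hl⟩ := exists_forall_hyperForm_torusParam_eq_zero
    (fun l => (((U i).symm.trans A).trans (U l)).toLinearMap)
    (fun x hx => h ((U i).symm x) ⟨i, by simpa using hx⟩)
  have hUs (x : ℂ × ℂ) : sqNorm ((U i).symm x) = sqNorm x := by
    rw [← hU i, LinearEquiv.apply_symm_apply]
  refine ⟨l, fun x => ?_⟩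
  simpa using hyperForm_comp_sq_of_forall_torusParam (((U i).symm.trans A).trans (U l))
    (fun x => by simp [hU, hA, hUs]) hl (U i x)

theorem exists_perm_hyperForm_comp_sq_eq {ι : Type*} [Finite ι]
    (U : ι → (ℂ × ℂ) ≃ₗ[ℝ] (ℂ × ℂ)) (hU : ∀ i x, sqNorm (U i x) = sqNorm x)
    (hinj : ∀ i j, (∀ x, hyperForm (U i x) ^ 2 = hyperForm (U j x) ^ 2) → i = j)
    (A : (ℂ × ℂ) ≃ₗ[ℝ] (ℂ × ℂ)) (hA : ∀ x, sqNorm (A x) = sqNorm x)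
    (h : ∀ x, sqNorm x = 1 → (∃ i, hyperForm (U i x) = 0) → ∃ l, hyperForm (U l (A x)) = 0) :
    ∃ σ : Equiv.Perm ι, ∀ i x, hyperForm (U (σ i) (A x)) ^ 2 = hyperForm (U i x) ^ 2 := by
  have hcone (x : ℂ × ℂ) (hx : ∃ i, hyperForm (U i x) = 0) :
      ∃ l, hyperForm (U l (A x)) = 0 := by
    obtain ⟨i, hi⟩ := hx
    rcases eq_or_ne x 0 with rfl | h0
    · exact ⟨i, by simp [hyperForm_zero]⟩
    have hpos := sqNorm_pos h0
    have ht : (√(sqNorm x))⁻¹ ^ 2 * sqNorm x = 1 := by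
      rw [inv_pow, Real.sq_sqrt hpos.le, inv_mul_cancel₀ hpos.ne']
    obtain ⟨l, hl⟩ := h ((√(sqNorm x))⁻¹ • x) (by rw [sqNorm_smul, ht])
      ⟨i, by rw [map_smul, hyperForm_smul, hi, mul_zero]⟩
    refine ⟨l, ?_⟩
    rw [map_smul, map_smul, hyperForm_smul] at hl
    exact (mul_eq_zero.1 hl).resolve_left fun h' => by simp [h'] at ht
  choose σ hσ using exists_hyperForm_comp_sq_eq U hU A hA hcone
  have hσi : Function.Injective σ := fun i j hij =>
    hinj i j fun x => by rw [← hσ i, ← hσ j, hij]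
  exact ⟨Equiv.ofBijective σ (Finite.injective_iff_bijective.1 hσi), hσ⟩

/-- The linear isometry of `ℂ × ℂ` taking the cone over the torus of angle `θ` to the cone over
`T'`. -/
noncomputable def rotateTorus (θ : ℝ) : (ℂ × ℂ) ≃ₗ[ℝ] (ℂ × ℂ) where
  toFun x := ((√2 : ℂ)⁻¹ * (x.1 - I * exp (-(θ * I)) * x.2),
    (√2 : ℂ)⁻¹ * (x.1 + I * exp (-(θ * I)) * x.2))
  invFun x := ((√2 : ℂ)⁻¹ * (x.1 + x.2), (√2 : ℂ)⁻¹ * (I * exp (θ * I) * (x.1 - x.2)))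
  map_add' x y := by ext <;> simp <;> ring
  map_smul' t x := by ext <;> simp <;> ring
  left_inv x := by
    have hs : (√2 : ℂ)⁻¹ * (√2 : ℂ)⁻¹ = 2⁻¹ := by
      rw [← mul_inv, ← ofReal_mul, Real.mul_self_sqrt (by norm_num)]; simp
    have he : exp (θ * I) * exp (-(θ * I)) = 1 := by rw [← Complex.exp_add]; simp
    ext1
    · linear_combination 2 * x.1 * hs
    · linear_combination (-2 * I * I * exp (θ * I) * exp (-(θ * I)) * x.2) * hs
        - I * I * x.2 * he - x.2 * I_mul_I
  right_inv x := by
    have hs : (√2 : ℂ)⁻¹ * (√2 : ℂ)⁻¹ = 2⁻¹ := by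
      rw [← mul_inv, ← ofReal_mul, Real.mul_self_sqrt (by norm_num)]; simp
    have he : exp (θ * I) * exp (-(θ * I)) = 1 := by rw [← Complex.exp_add]; simp
    ext1
    · linear_combination (x.1 + x.2 - I * I * exp (θ * I) * exp (-(θ * I)) * (x.1 - x.2)) * hs
        - 2⁻¹ * I * I * (x.1 - x.2) * he - 2⁻¹ * (x.1 - x.2) * I_mul_I
    · linear_combination (x.1 + x.2 + I * I * exp (θ * I) * exp (-(θ * I)) * (x.1 - x.2)) * hs
        + 2⁻¹ * I * I * (x.1 - x.2) * he + 2⁻¹ * (x.1 - x.2) * I_mul_I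

theorem hyperForm_rotateTorus (θ : ℝ) (x : ℂ × ℂ) :
    hyperForm (rotateTorus θ x) = 2 * (exp (-(θ * I)) * (x.2 * (starRingEnd ℂ) x.1)).im := by
  have hs : (√2)⁻¹ * (√2)⁻¹ = (2 : ℝ)⁻¹ := by
    rw [← mul_inv, Real.mul_self_sqrt (by norm_num)]
  simp only [hyperForm, rotateTorus, LinearEquiv.coe_mk, LinearMap.coe_mk, AddHom.coe_mk,
    normSq_mul, normSq_inv, normSq_ofReal, mul_inv, hs]
  simp [normSq_apply]
  ring

theorem sqNorm_rotateTorus (θ : ℝ) (x : ℂ × ℂ) : sqNorm (rotateTorus θ x) = sqNorm x := by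
  have hs : (√2)⁻¹ * (√2)⁻¹ = (2 : ℝ)⁻¹ := by
    rw [← mul_inv, Real.mul_self_sqrt (by norm_num)]
  have he : normSq (exp (-(θ * I))) = 1 := by
    rw [normSq_eq_norm_sq, ← neg_mul, ← ofReal_neg, norm_exp_ofReal_mul_I, one_pow]
  simp only [sqNorm, rotateTorus, LinearEquiv.coe_mk, LinearMap.coe_mk, AddHom.coe_mk,
    normSq_mul, normSq_inv, normSq_ofReal, mul_inv, hs, normSq_add, normSq_sub, normSq_I, he]
  ring

theorem exists_cos_sin_of_sq_add_sq_eq_one {a b : ℝ} (h : a ^ 2 + b ^ 2 = 1) :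
    ∃ r : ℝ, Real.cos r = a ∧ Real.sin r = b := by
  have hn : ‖(⟨a, b⟩ : ℂ)‖ = 1 := by
    rw [norm_eq_sqrt_sq_add_sq, h, Real.sqrt_one]
  refine ⟨arg ⟨a, b⟩, ?_, ?_⟩
  · simpa [hn] using norm_mul_cos_arg (⟨a, b⟩ : ℂ)
  · simpa [hn] using norm_mul_sin_arg (⟨a, b⟩ : ℂ)

/-- Two complex numbers with real ratio are real multiples of a common unit. -/
theorem exists_exp_mul_of_mul_conj_im_eq_zero {x y : ℂ} (h : (y * (starRingEnd ℂ) x).im = 0) :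
    ∃ z a b : ℝ, x = exp (z * I) * a ∧ y = exp (z * I) * b := by
  rcases eq_or_ne x 0 with rfl | hx
  · exact ⟨arg y, 0, ‖y‖, by simp, by rw [mul_comm, norm_mul_exp_arg_mul_I]⟩
  · refine ⟨arg x, ‖x‖, (y * (starRingEnd ℂ) x).re / ‖x‖,
      by rw [mul_comm, norm_mul_exp_arg_mul_I], ?_⟩
    have hn : (‖x‖ : ℂ) ≠ 0 := by simpa using hx
    have hr : (((y * (starRingEnd ℂ) x).re : ℝ) : ℂ) = y * (starRingEnd ℂ) x :=
      Complex.ext rfl (by simpa using h.symm)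
    rw [ofReal_div, hr]
    have hxx : (starRingEnd ℂ) x * x = ‖x‖ ^ 2 := conj_mul' x
    field_simp
    refine mul_right_cancel₀ hn ?_
    calc y * ‖x‖ * ‖x‖ = y * ((starRingEnd ℂ) x * x) := by rw [hxx]; ring
      _ = y * ((starRingEnd ℂ) x * (‖x‖ * exp (arg x * I))) := by rw [norm_mul_exp_arg_mul_I]
      _ = _ := by ring

theorem sqNorm_eq_one_and_hyperForm_rotateTorus_iff (θ : ℝ) (x : ℂ × ℂ) :
    sqNorm x = 1 ∧ hyperForm (rotateTorus θ x) = 0 ↔ ∃ r z : ℝ,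
      x = (exp (z * I) * (Real.cos r : ℂ), exp (z * I) * exp (θ * I) * (Real.sin r : ℂ)) := by
  have hu (t : ℝ) : normSq (exp (t * I)) = 1 := by
    rw [normSq_eq_norm_sq, norm_exp_ofReal_mul_I, one_pow]
  have he : exp (-(θ * I)) * exp (θ * I) = 1 := by rw [← Complex.exp_add]; simp
  rw [hyperForm_rotateTorus]
  constructor
  · rintro ⟨h1, h2⟩
    obtain ⟨z, a, b, hx, hy⟩ := exists_exp_mul_of_mul_conj_im_eq_zero
      (x := x.1) (y := exp (-(θ * I)) * x.2) (by rw [mul_assoc]; linarith)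
    have hx2 : x.2 = exp (z * I) * exp (θ * I) * b := by
      linear_combination exp (θ * I) * hy - x.2 * he
    have hab : a ^ 2 + b ^ 2 = 1 := by
      rw [← h1, sqNorm, hx, hx2]
      simp only [normSq_mul, hu, normSq_ofReal]
      ring
    obtain ⟨r, rfl, rfl⟩ := exists_cos_sin_of_sq_add_sq_eq_one hab
    exact ⟨r, z, Prod.ext hx hx2⟩
  · rintro ⟨r, z, rfl⟩
    constructor
    · simp only [sqNorm, normSq_mul, hu, normSq_ofReal, one_mul]
      linarith [Real.cos_sq_add_sin_sq r]
    · have : exp (-(θ * I)) * (exp (z * I) * exp (θ * I) * (Real.sin r : ℂ) *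
          (starRingEnd ℂ) (exp (z * I) * (Real.cos r : ℂ))) =
          ((Real.sin r * Real.cos r : ℝ) : ℂ) := by
        have hz : exp (z * I) * (starRingEnd ℂ) (exp (z * I)) = 1 := by
          rw [mul_conj, hu, ofReal_one]
        rw [map_mul, conj_ofReal, ofReal_mul]
        linear_combination (exp (z * I) * (starRingEnd ℂ) (exp (z * I)) * (Real.sin r : ℂ) *
          (Real.cos r : ℂ)) * he + (Real.sin r : ℂ) * (Real.cos r : ℂ) * hz
      rw [this, ofReal_im, mul_zero]

theorem mem_cliffordT'_iff (x : ℂ × ℂ) : x ∈ cliffordT' ↔ sqNorm x = 1 ∧ hyperForm x = 0 := by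
  have hu (t : ℝ) : normSq (exp (t * I)) = 1 := by
    rw [normSq_eq_norm_sq, norm_exp_ofReal_mul_I, one_pow]
  have hs : √2 * √2 = (2 : ℝ) := Real.mul_self_sqrt (by norm_num)
  constructor
  · rintro ⟨s, t, rfl⟩
    simp only [sqNorm, hyperForm, normSq_div, hu, normSq_ofReal, hs]
    norm_num
  · rintro ⟨h1, h2⟩
    have hexp (w : ℂ) (hw : normSq w = 1 / 2) : w = exp (arg w * I) / (√2 : ℂ) := by
      have hn : ‖w‖ = 1 / √2 := by
        rw [norm_def, hw, Real.sqrt_div zero_le_one, Real.sqrt_one]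
      have := norm_mul_exp_arg_mul_I w
      rw [hn, ofReal_div, ofReal_one] at this
      rw [← mul_one_div, mul_comm, this]
    unfold sqNorm at h1
    unfold hyperForm at h2
    exact ⟨arg x.1, arg x.2, Prod.ext (hexp _ (by linarith)) (hexp _ (by linarith))⟩

theorem mem_bigW_iff (k : ℕ) (x : ℂ × ℂ) :
    x ∈ bigW k ↔ sqNorm x = 1 ∧ ∃ j : Fin k, hyperForm (rotateTorus (j * π / k) x) = 0 := by
  have hT (j : ℤ) : x ∈ torusT k j ↔
      sqNorm x = 1 ∧ hyperForm (rotateTorus (((j : ℝ) - 1) * π / k) x) = 0 :=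
    (sqNorm_eq_one_and_hyperForm_rotateTorus_iff _ x).symm
  simp only [bigW, Set.mem_iUnion, hT, Finset.mem_Icc, exists_prop]
  constructor
  · rintro ⟨j, ⟨hj1, hjk⟩, h1, h2⟩
    obtain ⟨n, hn⟩ := Int.eq_ofNat_of_zero_le (sub_nonneg.2 hj1)
    refine ⟨h1, ⟨n, by lia⟩, ?_⟩
    have : (j : ℝ) - 1 = n := by exact_mod_cast hn
    rwa [this] at h2
  · rintro ⟨h1, j, h2⟩
    refine ⟨(j : ℤ) + 1, ⟨by lia, by have := j.2; lia⟩, h1, ?_⟩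
    simpa using h2

theorem sum_hyperForm_rotateTorus_sq {k : ℕ} (hk : 1 < k) (x : ℂ × ℂ) :
    ∑ j : Fin k, hyperForm (rotateTorus (j * π / k) x) ^ 2 =
      2 * k * (normSq x.1 * normSq x.2) := by
  set w := x.2 * (starRingEnd ℂ) x.1 with hw
  set ζ := (exp (2 * π * I / k))⁻¹ with hζ
  have hζk : IsPrimitiveRoot ζ k := (isPrimitiveRoot_exp k (by lia)).inv
  have hterm (j : ℕ) : hyperForm (rotateTorus (j * π / k) x) ^ 2 =
      2 * (normSq x.1 * normSq x.2) - 2 * (ζ ^ j * w ^ 2).re := by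
    set u := exp (-(((j * π / k : ℝ) : ℂ) * I)) with hu
    have hnu : normSq u = 1 := by
      rw [hu, normSq_eq_norm_sq, ← neg_mul, ← ofReal_neg, norm_exp_ofReal_mul_I, one_pow]
    have huζ : u ^ 2 = ζ ^ j := by
      rw [hu, hζ, ← Complex.exp_neg, ← Complex.exp_nat_mul, ← Complex.exp_nat_mul]
      congr 1
      push_cast
      ring
    have hn : normSq (u * w) = normSq x.1 * normSq x.2 := by
      rw [hw, normSq_mul, normSq_mul, hnu, normSq_conj]; ring
    rw [hyperForm_rotateTorus, ← hn, ← huζ, ← mul_pow, ← hw, ← hu, sq (u * w), mul_re,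
      normSq_apply]
    ring
  rw [Fin.sum_univ_eq_sum_range (fun j : ℕ => hyperForm (rotateTorus (j * π / k) x) ^ 2) k]
  simp only [hterm]
  rw [Finset.sum_sub_distrib, ← Finset.mul_sum (f := fun j => (ζ ^ j * w ^ 2).re), ← re_sum,
    ← Finset.sum_mul (f := fun j => ζ ^ j),
    hζk.geom_sum_eq_zero hk]
  simp
  ring

theorem rotateTorus_injective_sq {k : ℕ} (i j : Fin k)
    (h : ∀ x, hyperForm (rotateTorus (i * π / k) x) ^ 2 =
      hyperForm (rotateTorus (j * π / k) x) ^ 2) : i = j := by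
  have key (a b : ℝ) : hyperForm (rotateTorus a (1, exp (b * I))) = 2 * Real.sin (b - a) := by
    rw [hyperForm_rotateTorus, map_one, mul_one, ← Complex.exp_add, ← exp_ofReal_mul_I_im]
    congr 3
    push_cast
    ring
  have h0 := h (1, exp ((i * π / k : ℝ) * I))
  rw [key, key, sub_self, Real.sin_zero] at h0
  have hsin : Real.sin (i * π / k - j * π / k) = 0 := by nlinarith
  have hk : (0 : ℝ) < k := by exact_mod_cast i.pos
  have hi : (i : ℝ) * π / k < π := by
    rw [div_lt_iff₀ hk, mul_comm]
    exact mul_lt_mul_of_pos_left (by exact_mod_cast i.2) pi_pos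
  have hj : (j : ℝ) * π / k < π := by
    rw [div_lt_iff₀ hk, mul_comm]
    exact mul_lt_mul_of_pos_left (by exact_mod_cast j.2) pi_pos
  have hi0 : 0 ≤ (i : ℝ) * π / k := by positivity
  have hj0 : 0 ≤ (j : ℝ) * π / k := by positivity
  rw [Real.sin_eq_zero_iff_of_lt_of_lt (by linarith) (by linarith), sub_eq_zero,
    div_left_inj' hk.ne', mul_left_inj' pi_ne_zero] at hsin
  exact Fin.ext (by exact_mod_cast hsin)

theorem map_mem_cliffordT'_of_map_bigW {k : ℕ} (hk : 1 < k) (A : (ℂ × ℂ) ≃ₗ[ℝ] (ℂ × ℂ))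
    (hA : ∀ x, sqNorm (A x) = sqNorm x) (h : ∀ x ∈ bigW k, A x ∈ bigW k)
    (x : ℂ × ℂ) (hx : x ∈ cliffordT') : A x ∈ cliffordT' := by
  obtain ⟨σ, hσ⟩ := exists_perm_hyperForm_comp_sq_eq (fun j : Fin k => rotateTorus (j * π / k))
    (fun j => sqNorm_rotateTorus _) rotateTorus_injective_sq A hA
    (fun x h1 hx => ((mem_bigW_iff k _).1 (h x ((mem_bigW_iff k x).2 ⟨h1, hx⟩))).2)
  have hsum : 2 * (k : ℝ) * (normSq (A x).1 * normSq (A x).2) =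
      2 * k * (normSq x.1 * normSq x.2) := by
    rw [← sum_hyperForm_rotateTorus_sq hk, ← sum_hyperForm_rotateTorus_sq hk,
      ← Equiv.sum_comp σ]
    exact Finset.sum_congr rfl fun i _ => hσ i x
  have hk0 : (2 * k : ℝ) ≠ 0 := by positivity
  rw [mem_cliffordT'_iff] at hx ⊢
  refine ⟨(hA x).trans hx.1, ?_⟩
  rw [← sq_eq_zero_iff, hyperForm_sq, mul_left_cancel₀ hk0 hsum, hA, ← hyperForm_sq, hx.2]
  simp

theorem map_mem_bigW_of_map_union {k : ℕ} (hk : 2 < k) (A : (ℂ × ℂ) ≃ₗ[ℝ] (ℂ × ℂ))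
    (hA : ∀ x, sqNorm (A x) = sqNorm x)
    (h : ∀ x ∈ bigW k ∪ cliffordT', A x ∈ bigW k ∪ cliffordT')
    (x : ℂ × ℂ) (hx : x ∈ bigW k) : A x ∈ bigW k := by
  let U : Option (Fin k) → (ℂ × ℂ) ≃ₗ[ℝ] (ℂ × ℂ) := fun o =>
    o.elim (LinearEquiv.refl ℝ _) fun j => rotateTorus (j * π / k)
  have hnone (x : ℂ × ℂ) : hyperForm (U none x) = hyperForm x := rfl
  have hsome (j : Fin k) (x : ℂ × ℂ) :
      hyperForm (U (some j) x) = hyperForm (rotateTorus (j * π / k) x) := rfl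
  have hne (j : Fin k) : ¬ ∀ x, hyperForm (U none x) ^ 2 = hyperForm (U (some j) x) ^ 2 := by
    intro h'
    have := h' (1, 0)
    rw [hnone, hsome, hyperForm_rotateTorus] at this
    simp [hyperForm] at this
  have hmem (x : ℂ × ℂ) :
      x ∈ bigW k ∪ cliffordT' ↔ sqNorm x = 1 ∧ ∃ o, hyperForm (U o x) = 0 := by
    rw [Set.mem_union, mem_bigW_iff, mem_cliffordT'_iff, Option.exists]
    simp only [hnone, hsome, ← and_or_left]
    rw [or_comm]
  have hU (o : Option (Fin k)) (x : ℂ × ℂ) : sqNorm (U o x) = sqNorm x := by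
    cases o with
    | none => rfl
    | some j => exact sqNorm_rotateTorus _ x
  have hinj (o o' : Option (Fin k))
      (h' : ∀ x, hyperForm (U o x) ^ 2 = hyperForm (U o' x) ^ 2) : o = o' := by
    cases o with
    | none =>
      cases o' with
      | none => rfl
      | some j => exact absurd h' (hne j)
    | some i =>
      cases o' with
      | none => exact absurd (fun x => (h' x).symm) (hne i)
      | some j => exact congrArg some (rotateTorus_injective_sq i j h')
  obtain ⟨σ, hσ⟩ := exists_perm_hyperForm_comp_sq_eq U hU hinj A hA
    (fun x h1 hx => ((hmem _).1 (h x ((hmem x).2 ⟨h1, hx⟩))).2)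
  have hform (y : ℂ × ℂ) : ∑ o, hyperForm (U o y) ^ 2 =
      sqNorm y ^ 2 + (2 * k - 4) * (normSq y.1 * normSq y.2) := by
    rw [Fintype.sum_option]
    simp only [hnone, hsome]
    rw [sum_hyperForm_rotateTorus_sq (by lia), hyperForm_sq]
    ring
  have hk0 : (2 * k - 4 : ℝ) ≠ 0 := by
    have : (2 : ℝ) < k := by exact_mod_cast hk
    linarith
  have hinv (y : ℂ × ℂ) : hyperForm (A y) ^ 2 = hyperForm y ^ 2 := by
    have hsum : ∑ o, hyperForm (U o (A y)) ^ 2 = ∑ o, hyperForm (U o y) ^ 2 := by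
      rw [← Equiv.sum_comp σ]
      exact Finset.sum_congr rfl fun o _ => hσ o y
    rw [hform, hform, hA, add_right_inj] at hsum
    rw [hyperForm_sq, hyperForm_sq, hA, mul_left_cancel₀ hk0 hsum]
  rw [mem_bigW_iff] at hx ⊢
  obtain ⟨h1, j, hj⟩ := hx
  refine ⟨(hA x).trans h1, ?_⟩
  have hj' := hσ (some j)
  cases hl : σ (some j) with
  | none =>
    rw [hl] at hj'
    exact absurd (fun x => by rw [← hj', hnone, hnone, hinv]) (hne j)
  | some l =>
    refine ⟨l, ?_⟩
    have := hj' x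
    rw [hl, hsome, hsome, hj] at this
    simpa using this

theorem image_eq_iff_forall_mem (A : (ℂ × ℂ) ≃ₗ[ℝ] (ℂ × ℂ)) (S : Set (ℂ × ℂ)) :
    A '' S = S ↔ (∀ x ∈ S, A x ∈ S) ∧ ∀ x ∈ S, A.symm x ∈ S := by
  rw [Set.Subset.antisymm_iff, Set.image_subset_iff, ← LinearEquiv.coe_toEquiv,
    Equiv.image_eq_preimage_symm]
  rfl

/-- For `k > 2`, the stabilizer in `O(4)` of `𝒲'_k = 𝒲_k ∪ T'` coincides with the
stabilizer in `O(4)` of `𝒲_k`. -/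
theorem stabilizer_of_W'k_eq_stabilizer_of_Wk (k : ℕ) (hk : 2 < k) :
    {A : (ℂ × ℂ) ≃ₗ[ℝ] (ℂ × ℂ) |
      (∀ v w : ℂ × ℂ, realInner (A v) (A w) = realInner v w) ∧
        ⇑A '' (bigW k ∪ cliffordT') = bigW k ∪ cliffordT'} =
    {A : (ℂ × ℂ) ≃ₗ[ℝ] (ℂ × ℂ) |
      (∀ v w : ℂ × ℂ, realInner (A v) (A w) = realInner v w) ∧ ⇑A '' bigW k = bigW k} := by
  ext A
  simp only [Set.mem_ofPred_eq, image_eq_iff_forall_mem]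
  refine and_congr_right fun hinner => ?_
  have hA (x : ℂ × ℂ) : sqNorm (A x) = sqNorm x := by
    simp only [sqNorm_eq_realInner, hinner]
  have hA' (x : ℂ × ℂ) : sqNorm (A.symm x) = sqNorm x := by
    rw [← hA, LinearEquiv.apply_symm_apply]
  constructor
  · rintro ⟨h, h'⟩
    exact ⟨map_mem_bigW_of_map_union hk A hA h, map_mem_bigW_of_map_union hk A.symm hA' h'⟩
  · rintro ⟨h, h'⟩
    have hk' : 1 < k := by lia
    exact ⟨fun x => Or.imp (h x) (map_mem_cliffordT'_of_map_bigW hk' A hA h x),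
      fun x => Or.imp (h' x) (map_mem_cliffordT'_of_map_bigW hk' A.symm hA' h' x)⟩
end

section
/- Fix integers k ≥ 2 and m ≥ 1. The subgroup of O(4) generated by the reflections F_{φ₁,φ₂} : (z₁,z₂) ↦ (e^{2iφ₁}z̄₁, e^{2iφ₂}z̄₂) for all pairs (φ₁,φ₂) = (jπ/km, jπ/km + ℓπ/k) with j,ℓ ∈ ℤ, equals the subgroup generated by the three maps (z₁,z₂) ↦ (z̄₁, z̄₂), (z₁,z₂) ↦ (e^{2πi/km}z₁, e^{2πi/km}z₂), and (z₁,z₂) ↦ (z₁, e^{2πi/k}z₂). -/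
open Complex Real

/-- The reflections `F_{φ₁,φ₂}(z₁,z₂) = (e^{2iφ₁}z̄₁, e^{2iφ₂}z̄₂)` through the scaffold
circles `C_{jπ/km, jπ/km + ℓπ/k}`, for `j, ℓ ∈ ℤ`. -/
noncomputable def scaffoldReflections (k m : ℕ) : Set ((ℂ × ℂ) ≃ₗ[ℝ] (ℂ × ℂ)) :=
  {A | ∃ j ℓ : ℤ, ∀ z : ℂ × ℂ,
    A z = (Complex.exp (((2 * ((j : ℝ) * π / (k * m)) : ℝ) : ℂ) * Complex.I) *
             (starRingEnd ℂ) z.1,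
           Complex.exp (((2 * ((j : ℝ) * π / (k * m) + (ℓ : ℝ) * π / k) : ℝ) : ℂ) *
             Complex.I) * (starRingEnd ℂ) z.2)}

/-- The three generators `(z₁,z₂) ↦ (z̄₁, z̄₂)`,
`(z₁,z₂) ↦ (e^{2πi/km}z₁, e^{2πi/km}z₂)` and `(z₁,z₂) ↦ (z₁, e^{2πi/k}z₂)`. -/
noncomputable def threeGenerators (k m : ℕ) : Set ((ℂ × ℂ) ≃ₗ[ℝ] (ℂ × ℂ)) :=
  {A | (∀ z : ℂ × ℂ, A z = ((starRingEnd ℂ) z.1, (starRingEnd ℂ) z.2)) ∨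
       (∀ z : ℂ × ℂ,
         A z = (Complex.exp (((2 * π / (k * m) : ℝ) : ℂ) * Complex.I) * z.1,
                Complex.exp (((2 * π / (k * m) : ℝ) : ℂ) * Complex.I) * z.2)) ∨
       (∀ z : ℂ × ℂ,
         A z = (z.1, Complex.exp (((2 * π / k : ℝ) : ℂ) * Complex.I) * z.2))}

/-- The diagonal rotation `(z₁,z₂) ↦ (u z₁, v z₂)` of `ℂ²`, as a homomorphism from the
two-dimensional torus. -/
noncomputable def diagonalRotation : Circle × Circle →* ((ℂ × ℂ) ≃ₗ[ℝ] (ℂ × ℂ)) where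
  toFun u := (rotation u.1).toLinearEquiv.prodCongr (rotation u.2).toLinearEquiv
  map_one' := by ext z <;> simp
  map_mul' u v := by ext z <;> simp

theorem diagonalRotation_apply (u : Circle × Circle) (z : ℂ × ℂ) :
    diagonalRotation u z = (u.1 * z.1, u.2 * z.2) := by
  simp [diagonalRotation]

/-- Complex conjugation in both coordinates of `ℂ²`. -/
noncomputable def conjProd : (ℂ × ℂ) ≃ₗ[ℝ] (ℂ × ℂ) :=
  conjLIE.toLinearEquiv.prodCongr conjLIE.toLinearEquiv

theorem conjProd_apply (z : ℂ × ℂ) :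
    conjProd z = ((starRingEnd ℂ) z.1, (starRingEnd ℂ) z.2) := by
  simp [conjProd]

theorem conjProd_mul_self : conjProd * conjProd = 1 := by
  ext z <;> simp [conjProd_apply]

/-- The simultaneous rotation of both coordinates by the angle `2π/km`. -/
noncomputable def commonRotation (k m : ℕ) : (ℂ × ℂ) ≃ₗ[ℝ] (ℂ × ℂ) :=
  diagonalRotation (Circle.exp (2 * π / (k * m)), Circle.exp (2 * π / (k * m)))

/-- The rotation of the second coordinate by the angle `2π/k`. -/
noncomputable def secondRotation (k : ℕ) : (ℂ × ℂ) ≃ₗ[ℝ] (ℂ × ℂ) :=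
  diagonalRotation (1, Circle.exp (2 * π / k))

theorem commonRotation_apply (k m : ℕ) (z : ℂ × ℂ) :
    commonRotation k m z =
      (Complex.exp (((2 * π / (k * m) : ℝ) : ℂ) * Complex.I) * z.1,
        Complex.exp (((2 * π / (k * m) : ℝ) : ℂ) * Complex.I) * z.2) := by
  rw [commonRotation, diagonalRotation_apply, Circle.coe_exp]

theorem secondRotation_apply (k : ℕ) (z : ℂ × ℂ) :
    secondRotation k z =
      (z.1, Complex.exp (((2 * π / k : ℝ) : ℂ) * Complex.I) * z.2) := by
  rw [secondRotation, diagonalRotation_apply, Circle.coe_exp, Circle.coe_one, one_mul]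

theorem threeGenerators_eq (k m : ℕ) :
    threeGenerators k m = {conjProd, commonRotation k m, secondRotation k} := by
  ext A
  simp only [threeGenerators, Set.mem_ofPred_eq, Set.mem_insert_iff, Set.mem_singleton_iff,
    ← conjProd_apply, ← commonRotation_apply, ← secondRotation_apply, LinearEquiv.ext_iff]

theorem commonRotation_zpow_mul_secondRotation_zpow (k m : ℕ) (j l : ℤ) :
    commonRotation k m ^ j * secondRotation k ^ l =
      diagonalRotation (Circle.exp (2 * ((j : ℝ) * π / (k * m))),
        Circle.exp (2 * ((j : ℝ) * π / (k * m) + (l : ℝ) * π / k))) := by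
  rw [commonRotation, secondRotation, ← map_zpow, ← map_zpow, ← map_mul]
  congr 1
  ext1
  · simp only [Prod.fst_mul, Prod.pow_fst, one_zpow, mul_one, ← Circle.exp_zsmul]
    congr 1
    rw [zsmul_eq_mul]
    ring
  · simp only [Prod.snd_mul, Prod.pow_snd, ← Circle.exp_zsmul, ← Circle.exp_add]
    congr 1
    rw [zsmul_eq_mul, zsmul_eq_mul]
    ring

theorem scaffoldReflections_eq (k m : ℕ) :
    scaffoldReflections k m =
      {A | ∃ j l : ℤ, A = commonRotation k m ^ j * secondRotation k ^ l * conjProd} := by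
  ext A
  simp only [scaffoldReflections, Set.mem_ofPred_eq, LinearEquiv.ext_iff,
    commonRotation_zpow_mul_secondRotation_zpow, LinearEquiv.mul_apply, diagonalRotation_apply,
    conjProd_apply, Circle.coe_exp]

/-- The group `Grp_{k,m}` generated by the reflections through the scaffold circles of
`𝒞_{k,m}` equals the group generated by the three listed maps. -/
theorem scaffold_reflection_group_eq (k m : ℕ) (hk : 2 ≤ k) (hm : 1 ≤ m) :
    Subgroup.closure (scaffoldReflections k m) = Subgroup.closure (threeGenerators k m) := by
  rw [scaffoldReflections_eq, threeGenerators_eq]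
  refine le_antisymm ((Subgroup.closure_le _).2 ?_) ((Subgroup.closure_le _).2 ?_)
  · rintro _ ⟨j, l, rfl⟩
    exact mul_mem (mul_mem (zpow_mem (Subgroup.subset_closure (by simp)) j)
      (zpow_mem (Subgroup.subset_closure (by simp)) l)) (Subgroup.subset_closure (by simp))
  · set G := Subgroup.closure
      {A | ∃ j l : ℤ, A = commonRotation k m ^ j * secondRotation k ^ l * conjProd}
    have hG (j l : ℤ) : commonRotation k m ^ j * secondRotation k ^ l * conjProd ∈ G :=
      Subgroup.subset_closure ⟨j, l, rfl⟩
    have hconj : conjProd ∈ G := by simpa using hG 0 0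
    have hrot (j l : ℤ) : commonRotation k m ^ j * secondRotation k ^ l ∈ G := by
      simpa [mul_assoc, conjProd_mul_self] using mul_mem (hG j l) hconj
    rintro A (rfl | rfl | rfl)
    · exact hconj
    · simpa using hrot 1 0
    · simpa using hrot 0 1
end

section
/- Let k ≥ 2 be an integer and for j = 1,…,2k let ω_j = exp(iπ(1+2j)/(2k)) be the j-th 2k-th root of −1. Then for every z ∈ ℂ with z^{2k} ≠ −1, the partial fraction decomposition (1 − z^{2k−2})/(1 + z^{2k}) = −(1/k) ∑_{j=1}^{2k} Re(ω_j)/(z − ω_j) holds. -/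
open Complex Real

/-- The `j`-th `2k`-th root of `−1`, `ω_j = exp(iπ(1+2j)/(2k))`. -/
noncomputable def omegaRoot (k j : ℕ) : ℂ :=
  Complex.exp (((π * (1 + 2 * (j : ℝ)) / (2 * k) : ℝ) : ℂ) * Complex.I)

lemma omegaRoot_eq_mul_pow {k : ℕ} (hk : k ≠ 0) (j : ℕ) :
    omegaRoot k j = omegaRoot k 0 * Complex.exp (2 * π * Complex.I / (2 * k : ℕ)) ^ j := by
  have hk' : (k : ℂ) ≠ 0 := Nat.cast_ne_zero.mpr hk
  rw [omegaRoot, omegaRoot, ← Complex.exp_nat_mul, ← Complex.exp_add]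
  congr 1
  push_cast
  field_simp
  ring

lemma omegaRoot_pow_two_mul {k : ℕ} (hk : k ≠ 0) (j : ℕ) : omegaRoot k j ^ (2 * k) = -1 := by
  have hk' : (k : ℂ) ≠ 0 := Nat.cast_ne_zero.mpr hk
  rw [omegaRoot, ← Complex.exp_nat_mul, ← Complex.exp_pi_mul_I]
  refine Complex.exp_eq_exp_iff_exists_int.mpr ⟨j, ?_⟩
  push_cast
  field_simp

lemma sum_omegaRoot_pow_eq_zero {k m : ℕ} (hk : k ≠ 0) (hm : ¬ 2 * k ∣ m) :
    ∑ j ∈ Finset.Icc 1 (2 * k), omegaRoot k j ^ m = 0 := by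
  have hζ := Complex.isPrimitiveRoot_exp (2 * k) (by omega)
  have hne : Complex.exp (2 * π * Complex.I / (2 * k : ℕ)) ^ m ≠ 1 :=
    fun h => hm (hζ.dvd_of_pow_eq_one m h)
  have hpow : (Complex.exp (2 * π * Complex.I / (2 * k : ℕ)) ^ m) ^ (2 * k) = 1 := by
    rw [pow_right_comm, hζ.pow_eq_one, one_pow]
  rw [← Finset.Ico_add_one_right_eq_Icc, Finset.sum_Ico_eq_sum_range, Nat.add_sub_cancel]
  simp_rw [omegaRoot_eq_mul_pow hk (1 + _), mul_pow, pow_add, pow_one, mul_pow,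
    pow_right_comm _ _ m]
  rw [← Finset.mul_sum, ← Finset.mul_sum, geom_sum_eq hne, hpow]
  simp

lemma omegaRoot_re {k : ℕ} (hk : k ≠ 0) (j : ℕ) :
    ((omegaRoot k j).re : ℂ) =
      -(omegaRoot k j ^ (2 * k + 1) + omegaRoot k j ^ (2 * k - 1)) / 2 := by
  have hw : omegaRoot k j ≠ 0 := Complex.exp_ne_zero _
  have hnorm : ‖omegaRoot k j‖ = 1 := Complex.norm_exp_ofReal_mul_I _
  have hpow := omegaRoot_pow_two_mul hk j
  have hpred : omegaRoot k j ^ (2 * k - 1) = -(omegaRoot k j)⁻¹ := by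
    rw [pow_sub₀ _ hw (by omega), hpow, pow_one, neg_one_mul]
  rw [Complex.re_eq_add_conj, ← Complex.inv_eq_conj hnorm, hpred, pow_succ, hpow]
  ring

lemma omegaRoot_re_div_mul {k : ℕ} (hk : k ≠ 0) {z : ℂ} (hz : z ^ (2 * k) ≠ -1) (j : ℕ) :
    ((omegaRoot k j).re : ℂ) / (z - omegaRoot k j) * (1 + z ^ (2 * k)) =
      -(1 / 2) * ∑ i ∈ Finset.range (2 * k),
        z ^ i * (omegaRoot k j ^ (4 * k - i) + omegaRoot k j ^ (4 * k - 2 - i)) := by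
  have hpow := omegaRoot_pow_two_mul hk j
  have hsub : z - omegaRoot k j ≠ 0 := fun h => hz (by rw [sub_eq_zero.mp h, hpow])
  have hgeom := (Commute.all z (omegaRoot k j)).geom_sum₂_mul (2 * k)
  rw [hpow, sub_neg_eq_add, add_comm] at hgeom
  rw [← hgeom, div_mul_eq_mul_div, mul_div_assoc, mul_div_cancel_right₀ _ hsub,
    omegaRoot_re hk, Finset.mul_sum, Finset.mul_sum]
  refine Finset.sum_congr rfl fun i hi => ?_
  have hi := Finset.mem_range.mp hi
  rw [show 4 * k - i = (2 * k + 1) + (2 * k - 1 - i) by omega,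
    show 4 * k - 2 - i = (2 * k - 1) + (2 * k - 1 - i) by omega, pow_add, pow_add _ (2 * k - 1)]
  ring

lemma sum_omegaRoot_pow_four_mul_sub {k i : ℕ} (hk : k ≠ 0) (hi : i < 2 * k) :
    ∑ j ∈ Finset.Icc 1 (2 * k), omegaRoot k j ^ (4 * k - i) =
      if i = 0 then (2 * k : ℂ) else 0 := by
  split_ifs with h
  · simp [h, show 4 * k = 2 * k * 2 by ring, pow_mul _ (2 * k) 2, omegaRoot_pow_two_mul hk]
  · refine sum_omegaRoot_pow_eq_zero hk fun hdvd => ?_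
    have := (Nat.dvd_sub_iff_right (by omega) ⟨2, by ring⟩).mp hdvd
    exact h (Nat.eq_zero_of_dvd_of_lt this hi)

lemma sum_omegaRoot_pow_four_mul_sub_two_sub {k i : ℕ} (hk : 2 ≤ k) (hi : i < 2 * k) :
    ∑ j ∈ Finset.Icc 1 (2 * k), omegaRoot k j ^ (4 * k - 2 - i) =
      if i = 2 * k - 2 then (-(2 * k) : ℂ) else 0 := by
  split_ifs with h
  · rw [show 4 * k - 2 - i = 2 * k by omega]
    simp [omegaRoot_pow_two_mul (show k ≠ 0 by omega)]
  · refine sum_omegaRoot_pow_eq_zero (by omega) ?_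
    rintro ⟨c, hc⟩
    have hc0 : 0 < c := by
      rcases c.eq_zero_or_pos with rfl | hc'
      · omega
      · exact hc'
    have hc2 : c < 2 := by
      by_contra! hc'
      have := Nat.mul_le_mul_left (2 * k) hc'
      omega
    obtain rfl : c = 1 := by omega
    omega

/-- Partial fraction decomposition of the first Enneper–Weierstrass coordinate one-form of
the Karcher–Scherk tower of order `k`:
`(1 − z^{2k−2})/(1 + z^{2k}) = −(1/k) ∑_{j=1}^{2k} Re(ω_j)/(z − ω_j)`. -/
theorem partial_fraction_x_form (k : ℕ) (hk : 2 ≤ k) (z : ℂ) (hz : z ^ (2 * k) ≠ -1) :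
    (1 - z ^ (2 * k - 2)) / (1 + z ^ (2 * k)) =
      -(1 / (k : ℂ)) *
        ∑ j ∈ Finset.Icc 1 (2 * k), (((omegaRoot k j).re : ℂ)) / (z - omegaRoot k j) := by
  have hk0 : k ≠ 0 := by omega
  have hkC : (k : ℂ) ≠ 0 := Nat.cast_ne_zero.mpr hk0
  have hden : 1 + z ^ (2 * k) ≠ 0 := fun h => hz (eq_neg_of_add_eq_zero_right h)
  rw [div_eq_iff hden, mul_assoc, Finset.sum_mul]
  simp_rw [omegaRoot_re_div_mul hk0 hz]
  rw [← Finset.mul_sum, Finset.sum_comm]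
  simp_rw [← Finset.mul_sum, Finset.sum_add_distrib]
  have hsum : ∀ i ∈ Finset.range (2 * k),
      z ^ i * (∑ j ∈ Finset.Icc 1 (2 * k), omegaRoot k j ^ (4 * k - i) +
        ∑ j ∈ Finset.Icc 1 (2 * k), omegaRoot k j ^ (4 * k - 2 - i)) =
      (if i = 0 then z ^ i * (2 * k) else 0) +
        if i = 2 * k - 2 then z ^ i * (-(2 * k)) else 0 := by
    intro i hi
    have hi := Finset.mem_range.mp hi
    rw [sum_omegaRoot_pow_four_mul_sub hk0 hi, sum_omegaRoot_pow_four_mul_sub_two_sub hk hi,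
      mul_add, mul_ite, mul_ite, mul_zero]
  rw [Finset.sum_congr rfl hsum, Finset.sum_add_distrib, Finset.sum_ite_eq', Finset.sum_ite_eq',
    if_pos (Finset.mem_range.mpr (by omega)), if_pos (Finset.mem_range.mpr (by omega))]
  field_simp
  ring
end

section
/- Let k ≥ 2 be an integer, set φ(r) = (r^{2k−2} − 1)/(r^{2k−2} + 1) for r > 0, and define the first-order operators A₊u = r u' + (k−1)φ u and A₋u = r u' − (k−1)φ u. Then for every twice differentiable function u : (0,∞) → ℝ and every r > 0, r·(r u'(r))' + 8(k−1)² r^{2k−2}/(r^{2k−2}+1)² · u(r) = A₋(A₊u)(r) + (k−1)² u(r). -/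
open Real

/-- The function `φ(r) = (r ^ n - 1) / (r ^ n + 1)` satisfies
`r φ'(r) = 2 n r ^ n / (r ^ n + 1) ^ 2` for `r > 0`. -/
lemma hasDerivAt_pow_sub_one_div_pow_add_one (n : ℕ) {r : ℝ} (hr : 0 < r) :
    HasDerivAt (fun s : ℝ => (s ^ n - 1) / (s ^ n + 1))
      (2 * n * r ^ n / (r ^ n + 1) ^ 2 / r) r := by
  have hne : r ^ n + 1 ≠ 0 := by positivity
  have hpow : HasDerivAt (fun s : ℝ => s ^ n) (n * r ^ (n - 1)) r := hasDerivAt_pow n r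
  refine ((hpow.sub_const 1).fun_div (hpow.add_const 1) hne).congr_deriv ?_
  rcases n with _ | n
  · simp
  · rw [Nat.add_sub_cancel]
    field_simp
    ring

/-- Factorization of the radial part of the cylindrical Jacobi operator of the
Karcher–Scherk tower of order `k`: with `φ(r) = (r^{2k−2} − 1)/(r^{2k−2} + 1)`,
`A₊u = ru' + (k−1)φu` and `A₋u = ru' − (k−1)φu`, one has
`r(ru')' + 8(k−1)² r^{2k−2}/(r^{2k−2}+1)² u = A₋(A₊u) + (k−1)² u` on `(0,∞)`. -/
theorem jacobi_radial_factorization (k : ℕ) (hk : 2 ≤ k) (u : ℝ → ℝ)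
    (hu : ∀ r : ℝ, 0 < r → DifferentiableAt ℝ u r)
    (hu' : ∀ r : ℝ, 0 < r → DifferentiableAt ℝ (deriv u) r) :
    ∀ r : ℝ, 0 < r →
      r * deriv (fun s => s * deriv u s) r
          + 8 * ((k : ℝ) - 1) ^ 2 * r ^ (2 * k - 2) / (r ^ (2 * k - 2) + 1) ^ 2 * u r
        = (r * deriv (fun s => s * deriv u s
              + ((k : ℝ) - 1) * ((s ^ (2 * k - 2) - 1) / (s ^ (2 * k - 2) + 1)) * u s) r
            - ((k : ℝ) - 1) * ((r ^ (2 * k - 2) - 1) / (r ^ (2 * k - 2) + 1)) *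
              (r * deriv u r
                + ((k : ℝ) - 1) * ((r ^ (2 * k - 2) - 1) / (r ^ (2 * k - 2) + 1)) * u r))
          + ((k : ℝ) - 1) ^ 2 * u r := by
  intro r hr
  have hne : r ^ (2 * k - 2) + 1 ≠ 0 := by positivity
  have hcast : ((2 * k - 2 : ℕ) : ℝ) = 2 * ((k : ℝ) - 1) := by
    rw [Nat.cast_sub (by omega)]
    push_cast
    ring
  have hφ := hasDerivAt_pow_sub_one_div_pow_add_one (2 * k - 2) hr
  have hru : HasDerivAt (fun s => s * deriv u s) (1 * deriv u r + r * deriv (deriv u) r) r :=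
    (hasDerivAt_id' r).fun_mul (hu' r hr).hasDerivAt
  have hsum := hru.fun_add ((hφ.const_mul ((k : ℝ) - 1)).fun_mul (hu r hr).hasDerivAt)
  rw [hru.deriv, hsum.deriv, hcast]
  generalize r ^ (2 * k - 2) = x at hne ⊢
  field_simp
  ring
end

section
/- Let k ≥ 2 be an integer, λ ∈ ℝ, and define u_λ : (0,∞) → ℝ by u_λ(r) = (λ − (k−1)(r^{2k−2} − 1)/(r^{2k−2} + 1)) · r^λ. Then u_λ satisfies the radial eigenvalue equation r·(r u_λ'(r))' + 8(k−1)² r^{2k−2}/(r^{2k−2}+1)² · u_λ(r) = λ² u_λ(r) for all r > 0. In particular, for λ = 0 the function u₀(r) = −(k−1)(r^{2k−2} − 1)/(r^{2k−2} + 1) lies in the kernel of the radial operator and vanishes at r = 1. -/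
open Real

/-- The Euler operator `t d/dt` scales `t ^ n` by `n`. -/
lemma hasDerivAt_pow_div_self (n : ℕ) {t : ℝ} (ht : t ≠ 0) :
    HasDerivAt (fun x : ℝ => x ^ n) (n * t ^ n / t) t := by
  refine (hasDerivAt_pow n t).congr_deriv ?_
  cases n with
  | zero => simp
  | succ n => rw [pow_succ, Nat.add_sub_cancel]; field_simp

/-- The Euler operator `t d/dt` scales the real power `t ^ l` by `l`. -/
lemma hasDerivAt_rpow_div_self (l : ℝ) {t : ℝ} (ht : t ≠ 0) :
    HasDerivAt (fun x : ℝ => x ^ l) (l * t ^ l / t) t := by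
  refine (Real.hasDerivAt_rpow_const (Or.inl ht)).congr_deriv ?_
  rw [Real.rpow_sub_one ht, mul_div_assoc]

/-- The Euler derivative of the separated eigenfunction. -/
lemma mul_deriv_radial (m : ℕ) (l : ℝ) {t : ℝ} (ht : 0 < t) :
    t * deriv (fun x : ℝ => (l - m * ((x ^ (2 * m) - 1) / (x ^ (2 * m) + 1))) * x ^ l) t
      = (l * (l - m * ((t ^ (2 * m) - 1) / (t ^ (2 * m) + 1)))
          - 4 * m ^ 2 * (t ^ (2 * m) / (t ^ (2 * m) + 1) ^ 2)) * t ^ l := by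
  have hp := hasDerivAt_pow_div_self (2 * m) ht.ne'
  have hq := hasDerivAt_rpow_div_self l ht.ne'
  have h0 : t ^ (2 * m) + 1 ≠ 0 := by positivity
  have hφ := (((hp.sub_const 1).fun_div (hp.add_const 1) h0).const_mul (m : ℝ)).const_sub l
  have h := hφ.fun_mul hq
  rw [h.deriv]
  push_cast
  generalize t ^ (2 * m) = p at *
  generalize t ^ l = q at *
  field_simp
  ring

/-- The second Euler derivative of the separated eigenfunction. -/
lemma mul_deriv_mul_deriv_radial (m : ℕ) (l : ℝ) {t : ℝ} (ht : 0 < t) :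
    t * deriv (fun x : ℝ => (l * (l - m * ((x ^ (2 * m) - 1) / (x ^ (2 * m) + 1)))
          - 4 * m ^ 2 * (x ^ (2 * m) / (x ^ (2 * m) + 1) ^ 2)) * x ^ l) t
      = (l ^ 2 - 8 * m ^ 2 * t ^ (2 * m) / (t ^ (2 * m) + 1) ^ 2) *
          ((l - m * ((t ^ (2 * m) - 1) / (t ^ (2 * m) + 1))) * t ^ l) := by
  have hp := hasDerivAt_pow_div_self (2 * m) ht.ne'
  have hq := hasDerivAt_rpow_div_self l ht.ne'
  have h0 : t ^ (2 * m) + 1 ≠ 0 := by positivity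
  have hφ := (((hp.sub_const 1).fun_div (hp.add_const 1) h0).const_mul (m : ℝ)).const_sub l
  have hψ := (hp.fun_div ((hp.add_const 1).fun_pow 2) (pow_ne_zero 2 h0)).const_mul
    (4 * (m : ℝ) ^ 2)
  have h := ((hφ.const_mul l).fun_sub hψ).fun_mul hq
  rw [h.deriv]
  push_cast
  generalize t ^ (2 * m) = p at *
  generalize t ^ l = q at *
  field_simp
  ring

/-- The separated radial eigenfunctions of the cylindrical Jacobi operator of the
Karcher–Scherk tower of order `k`:
`u_λ(r) = (λ − (k−1)(r^{2k−2}−1)/(r^{2k−2}+1)) r^λ` satisfies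
`r(r u_λ')' + 8(k−1)² r^{2k−2}/(r^{2k−2}+1)² u_λ = λ² u_λ` on `(0,∞)`;
in particular `u₀` is in the kernel of the radial operator and `u₀(1) = 0`. -/
theorem radial_eigenfunction (k : ℕ) (hk : 2 ≤ k) (lam : ℝ) :
    (∀ r : ℝ, 0 < r →
      r * deriv (fun s => s * deriv
            (fun t => (lam - ((k : ℝ) - 1) * ((t ^ (2 * k - 2) - 1) / (t ^ (2 * k - 2) + 1)))
              * t ^ lam) s) r
          + 8 * ((k : ℝ) - 1) ^ 2 * r ^ (2 * k - 2) / (r ^ (2 * k - 2) + 1) ^ 2 *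
            ((lam - ((k : ℝ) - 1) * ((r ^ (2 * k - 2) - 1) / (r ^ (2 * k - 2) + 1))) * r ^ lam)
        = lam ^ 2 *
            ((lam - ((k : ℝ) - 1) * ((r ^ (2 * k - 2) - 1) / (r ^ (2 * k - 2) + 1))) * r ^ lam)) ∧
    ((0 : ℝ) - ((k : ℝ) - 1) * (((1 : ℝ) ^ (2 * k - 2) - 1) / ((1 : ℝ) ^ (2 * k - 2) + 1)))
        * (1 : ℝ) ^ (0 : ℝ) = 0 := by
  obtain ⟨m, rfl⟩ : ∃ m, k = m + 1 := ⟨k - 1, by omega⟩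
  have hm : 2 * (m + 1) - 2 = 2 * m := by omega
  have hc : ((m + 1 : ℕ) : ℝ) - 1 = m := by push_cast; ring
  rw [hm, hc]
  refine ⟨fun r hr => ?_, by simp⟩
  have he := (eventually_gt_nhds hr).mono fun s hs => mul_deriv_radial m lam hs
  rw [Filter.EventuallyEq.deriv_eq he, mul_deriv_mul_deriv_radial m lam hr]
  ring
end
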